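/- Representation of the group inverse of the essential part via the Hartwig–Spindelböck decomposition: with the decomposition data as in the context and assuming additionally that K is invertible, the matrix G := Û · fromBlocks(K⁻¹Σ₁⁻¹, K⁻¹Σ₁⁻¹K⁻¹L, 0, 0) · Û* satisfies the three group-inverse equations with respect to the essential part A_e := Û · fromBlocks(Σ₁K, Σ₁L, 0, 0) · Û*, namely: A_e·G·A_e = A_e, G·A_e·G = G, and A_e·G = G·A_e. -/

import Mathlib

open Matrix

/-- The dual complex numbers `𝔻ℂ := ℂ[ε]`, the trivial square-zero extension of `ℂ` by `ℂ`. -/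
abbrev DC := TrivSqZeroExt ℂ ℂ

/-- Star on dual complex numbers: `(a + b·ε)* = conj a + conj b · ε`. -/
instance : Star DC :=
  ⟨fun x => ((starRingEnd ℂ) x.fst, (starRingEnd ℂ) x.snd)⟩

/-- A positive appreciable real dual number: the standard part is a positive real and
the dual part is real. -/
def PosAppreciable (x : DC) : Prop :=
  (∃ a : ℝ, 0 < a ∧ x.fst = (a : ℂ)) ∧ (∃ b : ℝ, x.snd = (b : ℂ))

/-- A nonnegative infinitesimal real dual number: the standard part is `0` and
the dual part is a nonnegative real. -/
def NonnegInfinitesimal (x : DC) : Prop :=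
  x.fst = 0 ∧ ∃ b : ℝ, 0 ≤ b ∧ x.snd = (b : ℂ)

/-- The standard part of a dual complex matrix. -/
def stdPart {m n : Type*} (X : Matrix m n DC) : Matrix m n ℂ :=
  X.map TrivSqZeroExt.fst

/-- The dual part of a dual complex matrix. -/
def dualPart {m n : Type*} (X : Matrix m n DC) : Matrix m n ℂ :=
  X.map TrivSqZeroExt.snd

/-- A dual complex number with positive standard part is a unit. -/
theorem PosAppreciable.isUnit {x : DC} (hx : PosAppreciable x) : IsUnit x := by
  obtain ⟨⟨a, ha, hxa⟩, -⟩ := hx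
  rw [TrivSqZeroExt.isUnit_iff_isUnit_fst, hxa, isUnit_iff_ne_zero]
  exact_mod_cast ha.ne'

section GroupInverse

variable {m n R : Type*} [Fintype m] [Fintype n] [DecidableEq m] [CommRing R]

/-- A block row `[S * K, S * L]` padded with zeros, times its group inverse. -/
theorem fromBlocks_mul_groupInverse {K S : Matrix m m R} (L : Matrix m n R)
    (hK : IsUnit K) (hS : IsUnit S) :
    fromBlocks (S * K) (S * L) 0 (0 : Matrix n n R) *
        fromBlocks (K⁻¹ * S⁻¹) (K⁻¹ * S⁻¹ * K⁻¹ * L) 0 0 =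
      fromBlocks 1 (K⁻¹ * L) 0 0 := by
  have hK' := (isUnit_iff_isUnit_det K).mp hK
  have hS' := (isUnit_iff_isUnit_det S).mp hS
  simp [fromBlocks_multiply, Matrix.mul_assoc, hK', hS']

/-- The group inverse of a padded block row `[S * K, S * L]`, times that block row. -/
theorem groupInverse_mul_fromBlocks {K S : Matrix m m R} (L : Matrix m n R)
    (hK : IsUnit K) (hS : IsUnit S) :
    fromBlocks (K⁻¹ * S⁻¹) (K⁻¹ * S⁻¹ * K⁻¹ * L) 0 (0 : Matrix n n R) *
        fromBlocks (S * K) (S * L) 0 0 =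
      fromBlocks 1 (K⁻¹ * L) 0 0 := by
  have hK' := (isUnit_iff_isUnit_det K).mp hK
  have hS' := (isUnit_iff_isUnit_det S).mp hS
  simp [fromBlocks_multiply, Matrix.mul_assoc, hK', hS']

theorem fromBlocks_one_mul_fromBlocks (X Y : Matrix m n R) (P : Matrix m m R) :
    fromBlocks 1 X 0 (0 : Matrix n n R) * fromBlocks P Y 0 0 = fromBlocks P Y 0 0 := by
  simp [fromBlocks_multiply]

theorem conj_mul_conj {U V : Matrix m m R} (h : V * U = 1) (B C : Matrix m m R) :
    U * B * V * (U * C * V) = U * (B * C) * V := by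
  calc U * B * V * (U * C * V) = U * B * (V * U) * C * V := by simp only [Matrix.mul_assoc]
    _ = U * (B * C) * V := by rw [h]; simp only [Matrix.mul_assoc, Matrix.one_mul]

end GroupInverse

/-- The group inverse of the essential part via the Hartwig–Spindelböck decomposition. -/
theorem group_inverse_of_essential_part
    {r s : ℕ}
    -- `Û`, a unitary matrix
    (U : Matrix (Fin r ⊕ Fin s) (Fin r ⊕ Fin s) DC)
    (hU₁ : U * Uᴴ = 1) (hU₂ : Uᴴ * U = 1)
    -- the blocks `K, L, M, N` forming a unitary block matrix
    (K : Matrix (Fin r) (Fin r) DC) (L : Matrix (Fin r) (Fin s) DC)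
    (M : Matrix (Fin s) (Fin r) DC) (N : Matrix (Fin s) (Fin s) DC)
    (hW₁ : fromBlocks K L M N * (fromBlocks K L M N)ᴴ = 1)
    (hW₂ : (fromBlocks K L M N)ᴴ * fromBlocks K L M N = 1)
    -- `Σ₁` diagonal with positive appreciable real dual diagonal entries
    (S₁ : Matrix (Fin r) (Fin r) DC) (d₁ : Fin r → DC)
    (hS₁ : S₁ = Matrix.diagonal d₁) (hd₁ : ∀ i, PosAppreciable (d₁ i))
    -- `Σ₂` diagonal with nonnegative infinitesimal real dual diagonal entries
    (S₂ : Matrix (Fin s) (Fin s) DC) (d₂ : Fin s → DC)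
    (hS₂ : S₂ = Matrix.diagonal d₂) (hd₂ : ∀ i, NonnegInfinitesimal (d₂ i))
    -- the Hartwig–Spindelböck decomposition of `Â`
    (A : Matrix (Fin r ⊕ Fin s) (Fin r ⊕ Fin s) DC)
    (hA : A = U * fromBlocks (S₁ * K) (S₁ * L) (S₂ * M) (S₂ * N) * Uᴴ)
    -- `A_e`, the essential part of `Â`
    (Ae : Matrix (Fin r ⊕ Fin s) (Fin r ⊕ Fin s) DC)
    (hAe : Ae = U * fromBlocks (S₁ * K) (S₁ * L) 0 0 * Uᴴ)
    -- `K` is invertible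
    (hK : IsUnit K)
    -- `A_e^#`, the group inverse of the essential part
    (Aeg : Matrix (Fin r ⊕ Fin s) (Fin r ⊕ Fin s) DC)
    (hAeg : Aeg = U * fromBlocks (K⁻¹ * S₁⁻¹) (K⁻¹ * S₁⁻¹ * K⁻¹ * L) 0 0 * Uᴴ) :
    Ae * Aeg * Ae = Ae ∧ Aeg * Ae * Aeg = Aeg ∧ Ae * Aeg = Aeg * Ae := by
  have hS : IsUnit S₁ := by
    rw [hS₁, Matrix.isUnit_diagonal, Pi.isUnit_iff]
    exact fun i => (hd₁ i).isUnit
  subst hAe hAeg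
  simp only [conj_mul_conj hU₂, fromBlocks_mul_groupInverse L hK hS,
    groupInverse_mul_fromBlocks L hK hS, fromBlocks_one_mul_fromBlocks, and_self]
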